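/- Equivalence after serialisation: for every ABS configuration cn, MultiASP store σ, ABS value v and MultiASP value v', if v ≈_σ^cn v' and σ' = serialise(v', σ), then v ≈_{σ'}^cn v'. -/

import Mathlib

/-!
# Equivalence after serialisation (Lemma 4.4, first part)

Concrete rendering of runtime values, of the equivalence of values `≈_σ^cn`
(Definition 4.1) and of the serialisation function: `serialise(v, σ)` is the sub-store
of `σ` containing exactly the bindings of the object locations (recursively) reachable
from `v` in `σ`, following the co-inductive constraints
`serialise(o, σ) = (o ↦ σ(o)) ∪ serialise(σ(o), σ)`,
`serialise([x̄ ↦ v̄], σ) = ⋃_{v' ∈ v̄} serialise(v', σ)`, and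
`serialise(f, σ) = serialise(α, σ) = serialise(null, σ) = serialise(prim, σ) = ∅`.
-/

inductive Val : Type
  | int : Int → Val
  | bool : Bool → Val
  | null : Val
  | fut : ℕ → Val
  | absObj : ℕ → ℕ → Val                       -- ABS object name i_α
  | loc : ℕ → Val                              -- MultiASP store location
  | act : ℕ → Val                              -- activity name
  | mObj : ℕ → ℕ → List (String × Val) → Val   -- MultiASP object [cog ↦ α, Id ↦ i, x̄ ↦ v̄]

abbrev Store := ℕ → Option Val
abbrev AbsFutures := ℕ → Option Val

/-- Definition 4.1: equivalence of values. -/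
inductive VEquiv (σ : Store) (futs : AbsFutures) : Val → Val → Prop
  | int (n : Int) : VEquiv σ futs (.int n) (.int n)
  | bool (b : Bool) : VEquiv σ futs (.bool b) (.bool b)
  | null : VEquiv σ futs .null .null
  | fut (f : ℕ) : VEquiv σ futs (.fut f) (.fut f)
  | obj (i α : ℕ) (flds : List (String × Val)) :
      VEquiv σ futs (.absObj i α) (.mObj α i flds)
  | deref (v : Val) (o : ℕ) (w : Val) :
      σ o = some w → VEquiv σ futs v w → VEquiv σ futs v (.loc o)
  | futFollow (f : ℕ) (v' w : Val) :
      futs f = some v' → VEquiv σ futs v' w → VEquiv σ futs (.fut f) w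

/-- `Reach σ v o`: the object location `o` belongs to the domain of `serialise(v, σ)`,
i.e. `o` is reachable from `v` following store bindings and object fields. -/
inductive Reach (σ : Store) : Val → ℕ → Prop
  | here (o : ℕ) : Reach σ (.loc o) o
  | follow (o : ℕ) (w : Val) (o' : ℕ) :
      σ o = some w → Reach σ w o' → Reach σ (.loc o) o'
  | field (c i : ℕ) (flds : List (String × Val)) (x : String) (w : Val) (o' : ℕ) :
      (x, w) ∈ flds → Reach σ w o' → Reach σ (.mObj c i flds) o'

/-- Equivalence only depends on the store at the locations reachable from the right-hand value. -/
theorem VEquiv.of_eq_on_reach {σ σ' : Store} {futs : AbsFutures} {v v' : Val}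
    (h : VEquiv σ futs v v') (hσ : ∀ o, Reach σ v' o → σ' o = σ o) :
    VEquiv σ' futs v v' := by
  induction h with
  | int n => exact .int n
  | bool b => exact .bool b
  | null => exact .null
  | fut f => exact .fut f
  | obj i α flds => exact .obj i α flds
  | deref v o w hw _ ih =>
    exact .deref v o w ((hσ o (.here o)).trans hw)
      (ih fun o' ho' => hσ o' (.follow o w o' hw ho'))
  | futFollow f v' w hf _ ih => exact .futFollow f v' w hf (ih hσ)

/-- Lemma 4.4 (serialisation part):
`v ≈_σ^cn v' ∧ σ' = serialise(v', σ)  ⟹  v ≈_{σ'}^cn v'`.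
The store `σ'` is characterised as the restriction of `σ` to the locations reachable
from `v'`. -/
theorem vequiv_serialise (σ σ' : Store) (futs : AbsFutures) (v v' : Val)
    (h : VEquiv σ futs v v')
    (hser : ∀ o, (Reach σ v' o → σ' o = σ o) ∧ (¬ Reach σ v' o → σ' o = none)) :
    VEquiv σ' futs v v' :=
  h.of_eq_on_reach fun o => (hser o).1
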